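/- Let V = {v ∈ K^n : M^δ A v = A M v for all M ∈ Γ₀} (a linear subspace of K^n) and Θ = {g(v, Av, I) : v ∈ V}. Then Θ is a normal subgroup of Γ contained in H, and every normal subgroup of Γ that is contained in H is contained in Θ; i.e. Θ is the maximal normal subgroup of Γ contained in H. -/

import Mathlib

open Matrix

/-- The block matrix `g(u,v,M)` (with `Md = M^δ`): block rows `(1,0,0)`, `(u,M,0)`, `(v,0,Md)`. -/
def gmat {K : Type*} [Field K] {n : ℕ} (u v : Fin n → K)
    (M Md : Matrix (Fin n) (Fin n) K) :
    Matrix (Unit ⊕ Fin n ⊕ Fin n) (Unit ⊕ Fin n ⊕ Fin n) K :=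
  Matrix.fromBlocks 1 0 (Matrix.of fun i _ => Sum.elim u v i) (Matrix.fromBlocks M 0 0 Md)

/-- The underlying matrix of an element of a subgroup of `GL (Fin n) K`. -/
def mOf {K : Type*} [Field K] {n : ℕ} {Γ₀ : Subgroup (GL (Fin n) K)} (M : Γ₀) :
    Matrix (Fin n) (Fin n) K := ((M : GL (Fin n) K) : Matrix (Fin n) (Fin n) K)

section BlockMatrices

variable {K : Type*} [Field K] {n : ℕ}

theorem gmat_mul (u v w x : Fin n → K) (M Md N Nd : Matrix (Fin n) (Fin n) K) :
    gmat u v M Md * gmat w x N Nd = gmat (u + M *ᵥ w) (v + Md *ᵥ x) (M * N) (Md * Nd) := by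
  unfold gmat
  rw [Matrix.fromBlocks_multiply, Matrix.fromBlocks_multiply]
  congr 1
  · simp
  · simp
  · ext i _
    rcases i with i | i <;> simp [Matrix.mul_apply, Matrix.mulVec, dotProduct]
  · simp

theorem gmat_zero_one : gmat (0 : Fin n → K) 0 1 1 = 1 := by
  unfold gmat
  have hzero : (Matrix.of fun i (_ : Unit) =>
      Sum.elim (0 : Fin n → K) (0 : Fin n → K) i) = 0 := by
    ext i _
    rcases i with i | i <;> rfl
  rw [hzero, Matrix.fromBlocks_one, Matrix.fromBlocks_one]

theorem gmat_injective {u v w x : Fin n → K} {M Md N Nd : Matrix (Fin n) (Fin n) K}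
    (h : gmat u v M Md = gmat w x N Nd) : u = w ∧ v = x := by
  have h₂₁ := (Matrix.fromBlocks_inj.mp h).2.2.1
  constructor <;> funext i
  · exact congrFun₂ h₂₁ (Sum.inl i) ()
  · exact congrFun₂ h₂₁ (Sum.inr i) ()

theorem gmat_one_inv (u v : Fin n → K) : (gmat u v 1 1)⁻¹ = gmat (-u) (-v) 1 1 :=
  Matrix.inv_eq_right_inv (by simp [gmat_mul, gmat_zero_one])

theorem mOf_one {Γ₀ : Subgroup (GL (Fin n) K)} : mOf (1 : Γ₀) = 1 := rfl

theorem mOf_mul {Γ₀ : Subgroup (GL (Fin n) K)} (M N : Γ₀) : mOf (M * N) = mOf M * mOf N := rfl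

theorem gmat_conj {Γ₀ : Subgroup (GL (Fin n) K)} (u v w x : Fin n → K) (M N : Γ₀) :
    gmat u v (mOf M) (mOf N) * gmat w x 1 1 * (gmat u v (mOf M) (mOf N))⁻¹ =
      gmat (mOf M *ᵥ w) (mOf N *ᵥ x) 1 1 := by
  have hcomm : gmat u v (mOf M) (mOf N) * gmat w x 1 1 =
      gmat (mOf M *ᵥ w) (mOf N *ᵥ x) 1 1 * gmat u v (mOf M) (mOf N) := by
    simp [gmat_mul, add_comm]
  have hinv : gmat u v (mOf M) (mOf N) *
      gmat (-(mOf M⁻¹ *ᵥ u)) (-(mOf N⁻¹ *ᵥ v)) (mOf M⁻¹) (mOf N⁻¹) = 1 := by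
    simp [gmat_mul, gmat_zero_one, Matrix.mulVec_neg, ← mOf_mul, mOf_one]
  rw [hcomm, Matrix.inv_eq_right_inv hinv, Matrix.mul_assoc, hinv, Matrix.mul_one]

end BlockMatrices

theorem stmt6 (K : Type*) [Field K] (n : ℕ) (hn : 1 ≤ n)
    (Γ₀ : Subgroup (GL (Fin n) K)) (δ : Γ₀ →* Γ₀) (A B : GL (Fin n) K) :
    -- Γ, H, the subspace V = {v | M^δ A v = A M v ∀ M ∈ Γ₀}, and Θ = {g(v,Av,I) | v ∈ V}
    let Γ : Set (Matrix (Unit ⊕ Fin n ⊕ Fin n) (Unit ⊕ Fin n ⊕ Fin n) K) :=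
      {X | ∃ u v, ∃ M : Γ₀, X = gmat u v (mOf M) (mOf (δ M))}
    let H : Set (Matrix (Unit ⊕ Fin n ⊕ Fin n) (Unit ⊕ Fin n ⊕ Fin n) K) :=
      {X | ∃ u : Fin n → K, X = gmat u ((A : Matrix (Fin n) (Fin n) K).mulVec u) 1 1}
    let V : Set (Fin n → K) :=
      {v | ∀ M : Γ₀, (mOf (δ M) * (A : Matrix (Fin n) (Fin n) K)).mulVec v =
        ((A : Matrix (Fin n) (Fin n) K) * mOf M).mulVec v}
    let Θ : Set (Matrix (Unit ⊕ Fin n ⊕ Fin n) (Unit ⊕ Fin n ⊕ Fin n) K) :=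
      {X | ∃ v ∈ V, X = gmat v ((A : Matrix (Fin n) (Fin n) K).mulVec v) 1 1}
    -- Θ is a normal subgroup of Γ contained in H …
    Θ ⊆ H ∧ Θ ⊆ Γ ∧
    (1 : Matrix (Unit ⊕ Fin n ⊕ Fin n) (Unit ⊕ Fin n ⊕ Fin n) K) ∈ Θ ∧
    (∀ a ∈ Θ, ∀ b ∈ Θ, a * b ∈ Θ) ∧ (∀ a ∈ Θ, a⁻¹ ∈ Θ) ∧
    (∀ γ ∈ Γ, ∀ a ∈ Θ, γ * a * γ⁻¹ ∈ Θ) ∧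
    -- … and is maximal among such: every normal subgroup of Γ contained in H lies in Θ
    (∀ N : Set (Matrix (Unit ⊕ Fin n ⊕ Fin n) (Unit ⊕ Fin n ⊕ Fin n) K),
      N ⊆ H →
      (1 : Matrix (Unit ⊕ Fin n ⊕ Fin n) (Unit ⊕ Fin n ⊕ Fin n) K) ∈ N →
      (∀ a ∈ N, ∀ b ∈ N, a * b ∈ N) → (∀ a ∈ N, a⁻¹ ∈ N) →
      (∀ γ ∈ Γ, ∀ a ∈ N, γ * a * γ⁻¹ ∈ N) → N ⊆ Θ) := by
  intro Γ H V Θ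
  refine ⟨?_, ?_, ?_, ?_, ?_, ?_, ?_⟩
  · rintro _ ⟨v, -, rfl⟩
    exact ⟨v, rfl⟩
  · rintro _ ⟨v, -, rfl⟩
    exact ⟨v, _, 1, by rw [map_one, mOf_one]⟩
  · exact ⟨0, fun M => by simp, by rw [Matrix.mulVec_zero, gmat_zero_one]⟩
  · rintro _ ⟨v, hv, rfl⟩ _ ⟨w, hw, rfl⟩
    refine ⟨v + w, fun M => ?_, by simp [gmat_mul, Matrix.mulVec_add]⟩
    rw [Matrix.mulVec_add, Matrix.mulVec_add, hv M, hw M]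
  · rintro _ ⟨v, hv, rfl⟩
    refine ⟨-v, fun M => ?_, by rw [gmat_one_inv, Matrix.mulVec_neg]⟩
    rw [Matrix.mulVec_neg, Matrix.mulVec_neg, hv M]
  · rintro _ ⟨u, u', M, rfl⟩ _ ⟨v, hv, rfl⟩
    have hM := hv M
    simp only [← Matrix.mulVec_mulVec] at hM
    refine ⟨mOf M *ᵥ v, fun M' => ?_, by rw [gmat_conj, hM]⟩
    have hM' := hv (M' * M)
    simp only [map_mul, mOf_mul, ← Matrix.mulVec_mulVec] at hM' ⊢
    rw [← hM, hM']
  · intro N hNH _ _ _ hconj X hX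
    obtain ⟨u, rfl⟩ := hNH hX
    refine ⟨u, fun M => ?_, rfl⟩
    obtain ⟨w, hw⟩ := hNH (hconj _ ⟨0, 0, M, rfl⟩ _ hX)
    rw [gmat_conj] at hw
    obtain ⟨hw₁, hw₂⟩ := gmat_injective hw
    rw [← Matrix.mulVec_mulVec, ← Matrix.mulVec_mulVec, hw₂, hw₁]
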